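/- Let n1 ≥ n2 ≥ 2, n = n1 + n2, and 0 < ε < η < 1/2. Then there exist Δ > δ > 0 such that the following holds. Let C ∈ ℝ^{n×n} be the block-ambiguous cost matrix with C_{ii} = 0 for all i, C_{ij} = Δ for i ≠ j with i, j ≤ n1, and C_{ij} = δ for i ≠ j with i, j > n1 (cross-block entries arbitrary), and let D be the set of n×n doubly stochastic matrices whose cross-block entries vanish (P_{ij} = 0 whenever exactly one of i, j is ≤ n1). Then for every β > 0, the unique minimizer P_β of the entropic assignment objective F_{C,1/β} over D does not satisfy both: (1) P_{β,ii} ≥ 1 − ε for every i ≤ n1, and (2) P_{β,ii} ≤ 1 − η for every i > n1. -/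

import Mathlib

open scoped BigOperators

/-- A square real matrix is doubly stochastic if all entries are nonnegative and
every row and every column sums to `1`. -/
def IsDoublyStochastic {ι : Type*} [Fintype ι] (P : Matrix ι ι ℝ) : Prop :=
  (∀ i j, 0 ≤ P i j) ∧ (∀ i, ∑ j, P i j = 1) ∧ (∀ j, ∑ i, P i j = 1)

/-- The entropic assignment objective
`F_{C,ε}(P) = Σ_{i,j} C_{ij} P_{ij} + ε Σ_{i,j} P_{ij} log P_{ij}`. -/
noncomputable def entObj {ι : Type*} [Fintype ι] (C : Matrix ι ι ℝ) (ε : ℝ)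
    (P : Matrix ι ι ℝ) : ℝ :=
  (∑ i, ∑ j, C i j * P i j) + ε * ∑ i, ∑ j, P i j * Real.log (P i j)

/-- A doubly stochastic matrix on `Fin n1 ⊕ Fin n2` is block diagonal if all its
cross-block entries vanish. -/
def IsBlockDiagonalDS {n1 n2 : ℕ}
    (P : Matrix (Fin n1 ⊕ Fin n2) (Fin n1 ⊕ Fin n2) ℝ) : Prop :=
  IsDoublyStochastic P ∧ (∀ i j, P (Sum.inl i) (Sum.inr j) = 0) ∧
    (∀ i j, P (Sum.inr i) (Sum.inl j) = 0)

/-- A feasible matrix whose support contains that of `P` and whose logarithms are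
`-β C i j - a i` on its support is the only candidate for a minimizer of the entropic objective:
the gap between the objectives is a Kullback-Leibler divergence. -/
theorem eq_of_entObj_le_gibbs {ι : Type*} [Fintype ι] {C P Q : Matrix ι ι ℝ} {a : ι → ℝ}
    {β : ℝ} (hβ : 0 < β) (hP : IsDoublyStochastic P) (hQ : IsDoublyStochastic Q)
    (hsupp : ∀ i j, Q i j = 0 → P i j = 0)
    (hlog : ∀ i j, Q i j ≠ 0 → Real.log (Q i j) = -β * C i j - a i)
    (hle : entObj C (1 / β) P ≤ entObj C (1 / β) Q) : P = Q := by
  have gibbs : ∀ R : Matrix ι ι ℝ, IsDoublyStochastic R → (∀ i j, Q i j = 0 → R i j = 0) →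
      β * entObj C (1 / β) R
        = ∑ i, ∑ j, Q i j * InformationTheory.klFun (R i j / Q i j) - ∑ i, a i := by
    intro R hR hs
    have entry : ∀ i j, β * (C i j * R i j) + R i j * Real.log (R i j)
        = Q i j * InformationTheory.klFun (R i j / Q i j) + R i j - Q i j - a i * R i j := by
      intro i j
      by_cases hq : Q i j = 0
      · simp [hq, hs i j hq]
      · by_cases hr : R i j = 0
        · simp [hr, InformationTheory.klFun]
        · rw [InformationTheory.klFun, Real.log_div hr hq, hlog i j hq]
          field_simp
          ring
    have expand : β * entObj C (1 / β) R
        = ∑ i, ∑ j, (β * (C i j * R i j) + R i j * Real.log (R i j)) := by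
      simp only [entObj, Finset.sum_add_distrib, ← Finset.mul_sum]
      field_simp
    rw [expand]
    simp only [entry, Finset.sum_add_distrib, Finset.sum_sub_distrib, ← Finset.mul_sum,
      hR.2.1, hQ.2.1, mul_one]
    ring
  have nonneg : ∀ i j, 0 ≤ Q i j * InformationTheory.klFun (P i j / Q i j) := fun i j =>
    mul_nonneg (hQ.1 i j) (InformationTheory.klFun_nonneg (div_nonneg (hP.1 i j) (hQ.1 i j)))
  have gibbs_Q : ∑ i, ∑ j, Q i j * InformationTheory.klFun (Q i j / Q i j) = 0 := by
    refine Finset.sum_eq_zero fun i _ => Finset.sum_eq_zero fun j _ => ?_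
    by_cases hq : Q i j = 0
    · simp [hq]
    · simp [hq, InformationTheory.klFun_one]
  have hsum : ∑ i, ∑ j, Q i j * InformationTheory.klFun (P i j / Q i j) = 0 := by
    refine le_antisymm ?_ (Finset.sum_nonneg fun i _ => Finset.sum_nonneg fun j _ => nonneg i j)
    have h := mul_le_mul_of_nonneg_left hle hβ.le
    rw [gibbs P hP hsupp, gibbs Q hQ fun _ _ h => h, gibbs_Q] at h
    linarith
  ext i j
  by_cases hq : Q i j = 0
  · rw [hq, hsupp i j hq]
  · have hrow := (Finset.sum_eq_zero_iff_of_nonneg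
      fun i _ => Finset.sum_nonneg fun j _ => nonneg i j).1 hsum i (Finset.mem_univ i)
    have hij := (Finset.sum_eq_zero_iff_of_nonneg fun j _ => nonneg i j).1 hrow j
      (Finset.mem_univ j)
    have hkl := (mul_eq_zero.1 hij).resolve_left hq
    rw [InformationTheory.klFun_eq_zero_iff (div_nonneg (hP.1 i j) (hQ.1 i j))] at hkl
    exact (div_eq_one_iff_eq hq).1 hkl

/-- The row-normalized `m × m` kernel with diagonal weight `1` and off-diagonal weight `x`. -/
noncomputable def uniformKernel (m : ℕ) (x : ℝ) : Matrix (Fin m) (Fin m) ℝ :=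
  fun i j => (if i = j then 1 else x) / (1 + (m - 1) * x)

theorem one_add_mul_pos {m : ℕ} {x : ℝ} (hm : 2 ≤ m) (hx : 0 < x) :
    0 < 1 + ((m : ℝ) - 1) * x := by
  have : (2 : ℝ) ≤ m := by exact_mod_cast hm
  nlinarith

theorem uniformKernel_pos {m : ℕ} {x : ℝ} (hm : 2 ≤ m) (hx : 0 < x) (i j : Fin m) :
    0 < uniformKernel m x i j := by
  refine div_pos ?_ (one_add_mul_pos hm hx)
  split_ifs <;> simp [hx]

theorem isDoublyStochastic_uniformKernel {m : ℕ} {x : ℝ} (hm : 2 ≤ m) (hx : 0 < x) :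
    IsDoublyStochastic (uniformKernel m x) := by
  have hrow : ∀ i, ∑ j, uniformKernel m x i j = 1 := by
    intro i
    have hite : ∀ j, (if i = j then (1 : ℝ) else x) = x + if i = j then 1 - x else 0 := by
      intro j
      split_ifs <;> ring
    simp only [uniformKernel, ← Finset.sum_div]
    rw [div_eq_one_iff_eq (one_add_mul_pos hm hx).ne', Finset.sum_congr rfl fun j _ => hite j]
    simp [Finset.sum_add_distrib]
    ring
  refine ⟨fun i j => (uniformKernel_pos hm hx i j).le, hrow, fun j => ?_⟩
  rw [← hrow j]
  exact Finset.sum_congr rfl fun i _ => by simp only [uniformKernel, eq_comm]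

theorem isBlockDiagonalDS_fromBlocks {n1 n2 : ℕ} {A : Matrix (Fin n1) (Fin n1) ℝ}
    {B : Matrix (Fin n2) (Fin n2) ℝ} (hA : IsDoublyStochastic A) (hB : IsDoublyStochastic B) :
    IsBlockDiagonalDS (Matrix.fromBlocks A 0 0 B) := by
  refine ⟨⟨?_, ?_, ?_⟩, fun i j => rfl, fun i j => rfl⟩
  · rintro (i | i) (j | j)
    · exact hA.1 i j
    · exact le_rfl
    · exact le_rfl
    · exact hB.1 i j
  · rintro (i | i)
    · simpa using hA.2.1 i
    · simpa using hB.2.1 i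
  · rintro (j | j)
    · simpa using hA.2.2 j
    · simpa using hB.2.2 j

theorem log_uniformKernel {m : ℕ} (hm : 2 ≤ m) (β M : ℝ) (i j : Fin m) :
    Real.log (uniformKernel m (Real.exp (-β * M)) i j)
      = -β * (if i = j then 0 else M)
        - Real.log (1 + (m - 1) * Real.exp (-β * M)) := by
  have hZ := (one_add_mul_pos hm (Real.exp_pos (-β * M))).ne'
  unfold uniformKernel
  split_ifs
  · rw [Real.log_div one_ne_zero hZ]
    simp
  · rw [Real.log_div (Real.exp_pos _).ne' hZ, Real.log_exp]

/-- The minimizer over the block-diagonal matrices for a block-ambiguous cost. -/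
theorem eq_fromBlocks_uniformKernel_of_isMinimizer {n1 n2 : ℕ} (hn1 : 2 ≤ n1) (hn2 : 2 ≤ n2)
    {Δ δ β : ℝ} (hβ : 0 < β) {C P : Matrix (Fin n1 ⊕ Fin n2) (Fin n1 ⊕ Fin n2) ℝ}
    (hdiag : ∀ i, C i i = 0)
    (hΔ : ∀ i j : Fin n1, i ≠ j → C (Sum.inl i) (Sum.inl j) = Δ)
    (hδ : ∀ i j : Fin n2, i ≠ j → C (Sum.inr i) (Sum.inr j) = δ)
    (hP : IsBlockDiagonalDS P)
    (hmin : ∀ Q : Matrix (Fin n1 ⊕ Fin n2) (Fin n1 ⊕ Fin n2) ℝ, IsBlockDiagonalDS Q →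
      entObj C (1 / β) P ≤ entObj C (1 / β) Q) :
    P = Matrix.fromBlocks (uniformKernel n1 (Real.exp (-β * Δ))) 0 0
      (uniformKernel n2 (Real.exp (-β * δ))) := by
  have hQ := isBlockDiagonalDS_fromBlocks
    (isDoublyStochastic_uniformKernel hn1 (Real.exp_pos (-β * Δ)))
    (isDoublyStochastic_uniformKernel hn2 (Real.exp_pos (-β * δ)))
  refine eq_of_entObj_le_gibbs
    (a := Sum.elim (fun _ => Real.log (1 + (n1 - 1) * Real.exp (-β * Δ)))
      (fun _ => Real.log (1 + (n2 - 1) * Real.exp (-β * δ))))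
    hβ hP.1 hQ.1 ?_ ?_ (hmin _ hQ)
  · rintro (i | i) (j | j) h
    · exact absurd h (uniformKernel_pos hn1 (Real.exp_pos _) i j).ne'
    · exact hP.2.1 i j
    · exact hP.2.2 i j
    · exact absurd h (uniformKernel_pos hn2 (Real.exp_pos _) i j).ne'
  · rintro (i | i) (j | j) h
    · have hC : C (Sum.inl i) (Sum.inl j) = if i = j then 0 else Δ := by
        split_ifs with hij
        · rw [hij, hdiag]
        · exact hΔ i j hij
      rw [hC]
      exact log_uniformKernel hn1 β Δ i j
    · exact absurd rfl h
    · exact absurd rfl h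
    · have hC : C (Sum.inr i) (Sum.inr j) = if i = j then 0 else δ := by
        split_ifs with hij
        · rw [hij, hdiag]
        · exact hδ i j hij
      rw [hC]
      exact log_uniformKernel hn2 β δ i j

/-- Global-temperature trade-off for the block-ambiguous cost: for `n1 ≥ n2 ≥ 2` and
`0 < ε < η < 1/2` there exist margins `Δ > δ > 0` such that for every block-ambiguous cost
matrix `C` (zero diagonal, `Δ` off-diagonal within the first block, `δ` off-diagonal within
the second block, arbitrary cross-block entries) and every `β > 0`, the unique minimizer of
`F_{C,1/β}` over the block-diagonal doubly stochastic matrices cannot both have all first-block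
diagonal entries `≥ 1 − ε` and all second-block diagonal entries `≤ 1 − η`. -/
theorem block_ambiguous_no_global_temperature
    (n1 n2 : ℕ) (hn2 : 2 ≤ n2) (hn12 : n2 ≤ n1)
    (ε η : ℝ) (hε : 0 < ε) (hεη : ε < η) (hη : η < 1 / 2) :
    ∃ Δ δ : ℝ, 0 < δ ∧ δ < Δ ∧
      ∀ C : Matrix (Fin n1 ⊕ Fin n2) (Fin n1 ⊕ Fin n2) ℝ,
        (∀ i, C i i = 0) →
        (∀ i j : Fin n1, i ≠ j → C (Sum.inl i) (Sum.inl j) = Δ) →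
        (∀ i j : Fin n2, i ≠ j → C (Sum.inr i) (Sum.inr j) = δ) →
        ∀ β : ℝ, 0 < β →
          ∀ P : Matrix (Fin n1 ⊕ Fin n2) (Fin n1 ⊕ Fin n2) ℝ, IsBlockDiagonalDS P →
            (∀ Q : Matrix (Fin n1 ⊕ Fin n2) (Fin n1 ⊕ Fin n2) ℝ, IsBlockDiagonalDS Q →
              entObj C (1 / β) P ≤ entObj C (1 / β) Q) →
            ¬ ((∀ i : Fin n1, 1 - ε ≤ P (Sum.inl i) (Sum.inl i)) ∧
               (∀ i : Fin n2, P (Sum.inr i) (Sum.inr i) ≤ 1 - η)) := by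
  have hn1 : 2 ≤ n1 := hn2.trans hn12
  have hn2' : (1 : ℝ) ≤ (n2 : ℝ) - 1 := by
    have : (2 : ℝ) ≤ n2 := by exact_mod_cast hn2
    linarith
  have hn12' : (n2 : ℝ) ≤ n1 := by exact_mod_cast hn12
  have hr2 : 0 < η / (1 - η) := div_pos (hε.trans hεη) (by linarith)
  have hr : ε / (1 - ε) < η / (1 - η) := by
    rw [div_lt_div_iff₀ (by linarith) (by linarith)]
    nlinarith
  set r1 := ε / (1 - ε) with hr1_def
  set r2 := η / (1 - η) with hr2_def
  set t := (r2 - r1) / ((n2 : ℝ) - 1) with ht_def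
  have ht : 0 < t := div_pos (by linarith) (by linarith)
  refine ⟨1 + t, 1, one_pos, by linarith, ?_⟩
  rintro C hdiag hΔ hδ β hβ P hP hmin ⟨h1, h2⟩
  have hPeq := eq_fromBlocks_uniformKernel_of_isMinimizer hn1 hn2 hβ hdiag hΔ hδ hP hmin
  have hd1 := h1 ⟨0, by omega⟩
  have hd2 := h2 ⟨0, by omega⟩
  simp only [hPeq, Matrix.fromBlocks_apply₁₁, Matrix.fromBlocks_apply₂₂, uniformKernel,
    if_true] at hd1 hd2
  rw [le_div_iff₀ (one_add_mul_pos hn1 (Real.exp_pos _))] at hd1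
  rw [div_le_iff₀ (one_add_mul_pos hn2 (Real.exp_pos _))] at hd2
  have hup : ((n1 : ℝ) - 1) * Real.exp (-β * (1 + t)) ≤ r1 := by
    rw [hr1_def, le_div_iff₀ (by linarith)]
    linarith
  have hlow : r2 ≤ ((n2 : ℝ) - 1) * Real.exp (-β * 1) := by
    rw [hr2_def, div_le_iff₀ (by linarith)]
    linarith
  have hβr : r2 * β < (n2 : ℝ) - 1 := by
    have hexp : β < Real.exp β := by linarith [Real.add_one_le_exp β]
    calc r2 * β < r2 * Real.exp β := mul_lt_mul_of_pos_left hexp hr2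
      _ ≤ ((n2 : ℝ) - 1) * Real.exp (-β * 1) * Real.exp β :=
          mul_le_mul_of_nonneg_right hlow (Real.exp_pos _).le
      _ = (n2 : ℝ) - 1 := by rw [mul_assoc, ← Real.exp_add]; simp
  have htβ : r2 * (t * β) < r2 - r1 := by
    calc r2 * (t * β) = t * (r2 * β) := by ring
      _ < t * ((n2 : ℝ) - 1) := mul_lt_mul_of_pos_left hβr ht
      _ = r2 - r1 := div_mul_cancel₀ _ (by linarith)
  have hchain : r1 < r1 := by
    calc r1 < r2 * (1 - t * β) := by linarith
      _ ≤ r2 * Real.exp (-(t * β)) :=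
          mul_le_mul_of_nonneg_left (Real.one_sub_le_exp_neg _) hr2.le
      _ ≤ ((n2 : ℝ) - 1) * Real.exp (-β * 1) * Real.exp (-(t * β)) :=
          mul_le_mul_of_nonneg_right hlow (Real.exp_pos _).le
      _ = ((n2 : ℝ) - 1) * Real.exp (-β * (1 + t)) := by
          rw [mul_assoc, ← Real.exp_add]
          ring_nf
      _ ≤ ((n1 : ℝ) - 1) * Real.exp (-β * (1 + t)) :=
          mul_le_mul_of_nonneg_right (by linarith) (Real.exp_pos _).le
      _ ≤ r1 := hup
  exact lt_irrefl _ hchain
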